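/- Bound on achievable utility under LDP: let U, X, Z be random variables on finite sets such that U and Z are conditionally independent given X (the Markov chain U → X → Z), and suppose the conditional distribution of Z given X is realized by a Markov kernel K from 𝒳 to 𝒵 satisfying ε-LDP. Then the utility satisfies I(U; Z) ≤ I(X; Z) ≤ ε. -/

import Mathlib

open Finset

noncomputable section

/-- A Markov kernel between finite types: each row is a probability mass function. -/
def IsMarkovKernel' {A B : Type*} [Fintype B] (K : A → B → ℝ) : Prop :=
  (∀ a b, 0 ≤ K a b) ∧ ∀ a, ∑ b, K a b = 1

/-- ε-local differential privacy for a kernel. -/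
def IsLDP {A B : Type*} (ε : ℝ) (K : A → B → ℝ) : Prop :=
  ∀ a a' b, K a b ≤ Real.exp ε * K a' b

variable {U X Z : Type*} [Fintype U] [Fintype X] [Fintype Z]

/-- Marginal of the utility variable. -/
def margU (p : U → X → Z → ℝ) (u : U) : ℝ := ∑ x, ∑ z, p u x z

/-- Marginal of the data variable. -/
def margX (p : U → X → Z → ℝ) (x : X) : ℝ := ∑ u, ∑ z, p u x z

/-- Marginal of the representation variable. -/
def margZ (p : U → X → Z → ℝ) (z : Z) : ℝ := ∑ u, ∑ x, p u x z

/-- Marginal of the pair `(U, X)`. -/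
def margUX (p : U → X → Z → ℝ) (u : U) (x : X) : ℝ := ∑ z, p u x z

/-- Marginal of the pair `(U, Z)`. -/
def margUZ (p : U → X → Z → ℝ) (u : U) (z : Z) : ℝ := ∑ x, p u x z

/-- Marginal of the pair `(X, Z)`. -/
def margXZ (p : U → X → Z → ℝ) (x : X) (z : Z) : ℝ := ∑ u, p u x z

/-- Mutual information `I(U;Z)` in nats (zero-probability terms vanish). -/
def miUZ (p : U → X → Z → ℝ) : ℝ :=
  ∑ u, ∑ z, margUZ p u z * Real.log (margUZ p u z / (margU p u * margZ p z))

/-- Mutual information `I(X;Z)` in nats (zero-probability terms vanish). -/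
def miXZ (p : U → X → Z → ℝ) : ℝ :=
  ∑ x, ∑ z, margXZ p x z * Real.log (margXZ p x z / (margX p x * margZ p z))

/-- The Markov chain `U → X → Z`: `p(u, z | x) = p(u|x) p(z|x)` whenever `p(x) > 0`. -/
def MarkovUXZ (p : U → X → Z → ℝ) : Prop :=
  ∀ x, 0 < margX p x → ∀ u z,
    p u x z / margX p x = (margUX p u x / margX p x) * (margXZ p x z / margX p x)

theorem mul_log_div_sub_mul_log_div_ge {r a b c d e f : ℝ} (hr : 0 < r) (ha : 0 < a)
    (hb : 0 < b) (hc : 0 < c) (hd : 0 < d) (he : 0 < e) (h : r * b = f * a) :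
    r - f * d / e ≤ r * Real.log (a / (b * c)) - r * Real.log (d / (e * c)) := by
  have hlog : Real.log (a / (b * c)) - Real.log (d / (e * c)) = -Real.log (b * d / (a * e)) := by
    rw [← Real.log_div (by positivity) (by positivity), ← Real.log_inv]
    congr 1
    field_simp
  have hle := Real.log_le_sub_one_of_pos (show 0 < b * d / (a * e) by positivity)
  have hf : f * d / e = r * (b * d / (a * e)) := by
    have hf' : f = r * b / a := by rw [h]; field_simp
    rw [hf']
    field_simp
  rw [← mul_sub, hlog, hf]
  nlinarith

section Marginals

variable {p : U → X → Z → ℝ}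

theorem le_margU (hp0 : ∀ u x z, 0 ≤ p u x z) (u : U) (x : X) (z : Z) :
    p u x z ≤ margU p u :=
  (single_le_sum (f := fun z => p u x z) (fun _ _ => hp0 _ _ _) (mem_univ z)).trans
    (single_le_sum (f := fun x => ∑ z, p u x z)
      (fun _ _ => sum_nonneg fun _ _ => hp0 _ _ _) (mem_univ x))

theorem le_margX (hp0 : ∀ u x z, 0 ≤ p u x z) (u : U) (x : X) (z : Z) :
    p u x z ≤ margX p x :=
  (single_le_sum (f := fun z => p u x z) (fun _ _ => hp0 _ _ _) (mem_univ z)).trans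
    (single_le_sum (f := fun u => ∑ z, p u x z)
      (fun _ _ => sum_nonneg fun _ _ => hp0 _ _ _) (mem_univ u))

theorem le_margZ (hp0 : ∀ u x z, 0 ≤ p u x z) (u : U) (x : X) (z : Z) :
    p u x z ≤ margZ p z :=
  (single_le_sum (f := fun x => p u x z) (fun _ _ => hp0 _ _ _) (mem_univ x)).trans
    (single_le_sum (f := fun u => ∑ x, p u x z)
      (fun _ _ => sum_nonneg fun _ _ => hp0 _ _ _) (mem_univ u))

theorem le_margUZ (hp0 : ∀ u x z, 0 ≤ p u x z) (u : U) (x : X) (z : Z) :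
    p u x z ≤ margUZ p u z :=
  single_le_sum (f := fun x => p u x z) (fun _ _ => hp0 _ _ _) (mem_univ x)

theorem le_margXZ (hp0 : ∀ u x z, 0 ≤ p u x z) (u : U) (x : X) (z : Z) :
    p u x z ≤ margXZ p x z :=
  single_le_sum (f := fun u => p u x z) (fun _ _ => hp0 _ _ _) (mem_univ u)

theorem sum_margUX (u : U) : ∑ x, margUX p u x = margU p u := rfl

theorem sum_margUZ (u : U) : ∑ z, margUZ p u z = margU p u := sum_comm

theorem sum_margXZ (z : Z) : ∑ x, margXZ p x z = margZ p z := sum_comm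

theorem sum_margX (hp1 : ∑ u, ∑ x, ∑ z, p u x z = 1) : ∑ x, margX p x = 1 :=
  sum_comm.trans hp1

theorem miUZ_eq_sum : miUZ p = ∑ u, ∑ x, ∑ z,
    p u x z * Real.log (margUZ p u z / (margU p u * margZ p z)) := by
  refine sum_congr rfl fun u _ => ?_
  rw [sum_comm]
  exact sum_congr rfl fun z _ => sum_mul _ _ _

theorem miXZ_eq_sum : miXZ p = ∑ u, ∑ x, ∑ z,
    p u x z * Real.log (margXZ p x z / (margX p x * margZ p z)) := by
  rw [sum_comm]
  refine sum_congr rfl fun x _ => ?_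
  rw [sum_comm]
  exact sum_congr rfl fun z _ => sum_mul _ _ _

/-- The data processing inequality for the Markov chain `U → X → Z`. -/
theorem miUZ_le_miXZ (hp0 : ∀ u x z, 0 ≤ p u x z) (hMarkov : MarkovUXZ p) :
    miUZ p ≤ miXZ p := by
  have key : ∀ u x z, p u x z - margUX p u x * margUZ p u z / margU p u ≤
      p u x z * Real.log (margXZ p x z / (margX p x * margZ p z)) -
        p u x z * Real.log (margUZ p u z / (margU p u * margZ p z)) := by
    intro u x z
    rcases (hp0 u x z).eq_or_lt with h | h
    · have hUX : 0 ≤ margUX p u x := sum_nonneg fun _ _ => hp0 _ _ _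
      have hUZ : 0 ≤ margUZ p u z := sum_nonneg fun _ _ => hp0 _ _ _
      have hU : 0 ≤ margU p u := (hp0 u x z).trans (le_margU hp0 u x z)
      rw [← h]
      simp only [zero_mul, sub_self, zero_sub, neg_nonpos]
      positivity
    · have hX := h.trans_le (le_margX hp0 u x z)
      refine mul_log_div_sub_mul_log_div_ge h (h.trans_le (le_margXZ hp0 u x z)) hX
        (h.trans_le (le_margZ hp0 u x z)) (h.trans_le (le_margUZ hp0 u x z))
        (h.trans_le (le_margU hp0 u x z)) ?_
      have hM := hMarkov x hX u z
      field_simp at hM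
      linarith
  have hsum : ∑ u, ∑ x, ∑ z, (p u x z - margUX p u x * margUZ p u z / margU p u) = 0 := by
    refine sum_eq_zero fun u _ => ?_
    simp only [sum_sub_distrib, ← sum_div, ← mul_sum, ← sum_mul, sum_margUX, sum_margUZ,
      mul_self_div_self]
    exact sub_self _
  rw [← sub_nonneg, miUZ_eq_sum, miXZ_eq_sum]
  simp only [← sum_sub_distrib]
  rw [← hsum]
  exact sum_le_sum fun u _ => sum_le_sum fun x _ => sum_le_sum fun z _ => key u x z

theorem IsLDP.le_exp_mul_margZ {ε : ℝ} {K : X → Z → ℝ} (hLDP : IsLDP ε K)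
    (hp0 : ∀ u x z, 0 ≤ p u x z) (hp1 : ∑ u, ∑ x, ∑ z, p u x z = 1)
    (hreal : ∀ x z, margXZ p x z = margX p x * K x z) (x : X) (z : Z) :
    K x z ≤ Real.exp ε * margZ p z := by
  rw [← sum_margXZ, mul_sum, ← one_mul (K x z), ← sum_margX hp1, sum_mul]
  refine sum_le_sum fun x' _ => ?_
  rw [hreal, mul_left_comm]
  exact mul_le_mul_of_nonneg_left (hLDP x x' z)
    (sum_nonneg fun _ _ => sum_nonneg fun _ _ => hp0 _ _ _)

theorem IsLDP.miXZ_le {ε : ℝ} {K : X → Z → ℝ} (hLDP : IsLDP ε K)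
    (hp0 : ∀ u x z, 0 ≤ p u x z) (hp1 : ∑ u, ∑ x, ∑ z, p u x z = 1)
    (hreal : ∀ x z, margXZ p x z = margX p x * K x z) : miXZ p ≤ ε := by
  have key : ∀ u x z, p u x z * Real.log (margXZ p x z / (margX p x * margZ p z)) ≤
      p u x z * ε := by
    intro u x z
    rcases (hp0 u x z).eq_or_lt with h | h
    · simp [← h]
    · have hX := h.trans_le (le_margX hp0 u x z)
      have hZ := h.trans_le (le_margZ hp0 u x z)
      have hXZ := h.trans_le (le_margXZ hp0 u x z)
      refine mul_le_mul_of_nonneg_left ?_ h.le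
      rw [Real.log_le_iff_le_exp (by positivity), hreal, mul_div_mul_left _ _ hX.ne',
        div_le_iff₀ hZ]
      exact hLDP.le_exp_mul_margZ hp0 hp1 hreal x z
  calc miXZ p ≤ ∑ u, ∑ x, ∑ z, p u x z * ε := by
        rw [miXZ_eq_sum]
        exact sum_le_sum fun u _ => sum_le_sum fun x _ => sum_le_sum fun z _ => key u x z
    _ = ε := by simp only [← sum_mul, hp1, one_mul]

end Marginals

/-- Bound on achievable utility under LDP: under the Markov chain `U → X → Z` with an
ε-LDP kernel realizing the conditional of `Z` given `X`, `I(U;Z) ≤ I(X;Z) ≤ ε`. -/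
theorem utility_bound_under_ldp
    [Nonempty U] [Nonempty X] [Nonempty Z]
    (ε : ℝ) (hε : 0 ≤ ε)
    (p : U → X → Z → ℝ)
    (hp0 : ∀ u x z, 0 ≤ p u x z) (hp1 : ∑ u, ∑ x, ∑ z, p u x z = 1)
    (hMarkov : MarkovUXZ p)
    (K : X → Z → ℝ) (hK : IsMarkovKernel' K) (hLDP : IsLDP ε K)
    (hreal : ∀ x z, margXZ p x z = margX p x * K x z) :
    miUZ p ≤ miXZ p ∧ miXZ p ≤ ε :=
  ⟨miUZ_le_miXZ hp0 hMarkov, hLDP.miXZ_le hp0 hp1 hreal⟩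

end
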